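/- arXiv:0910.1992 — 2 statements merged into one kernel-verified Lean document; each statement's English description precedes it below -/
import Mathlib

section
/- Let R be a commutative ring, A a commutative unital R-algebra, Δ : A → A an R-linear map, and d : A → A an R-derivation of A (i.e. d(ab) = d(a)·b + a·d(b) for all a, b ∈ A) such that d ∘ Δ = Δ ∘ d. Then d acts as a derivation over all the Koszul brackets of Δ: for every n ≥ 1 and all a₁,…,a_n ∈ A, d(Φⁿ_Δ(a₁,…,a_n)) = Σ_{i=1}^{n} Φⁿ_Δ(a₁,…,d(a_i),…,a_n). -/
/-- The nested-commutator operator `[⋯[[Δ, m_{a₁}], m_{a₂}]⋯, m_{a_n}]`, where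
`m_a` is multiplication by `a` and `[·,·]` is the commutator of endomorphisms. -/
def koszulOp {R A : Type*} [CommRing R] [CommRing A] [Algebra R A]
    (Δ : Module.End R A) (l : List A) : Module.End R A :=
  l.foldl (fun D a => ⁅D, LinearMap.mulLeft R a⁆) Δ

/-- The Koszul hierarchy of higher derived brackets of an `R`-linear map `Δ : A → A`:
`Φⁿ_Δ(a₁,…,a_n) = [⋯[[Δ, m_{a₁}], m_{a₂}]⋯, m_{a_n}](1)`. -/
def koszulBracket {R A : Type*} [CommRing R] [CommRing A] [Algebra R A]
    (Δ : Module.End R A) (l : List A) : A :=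
  koszulOp Δ l 1

section KoszulOp

variable {R A : Type*} [CommRing R] [CommRing A] [Algebra R A]

theorem koszulOp_cons (Δ : Module.End R A) (a : A) (l : List A) :
    koszulOp Δ (a :: l) = koszulOp ⁅Δ, LinearMap.mulLeft R a⁆ l := rfl

theorem koszulOp_add (Δ Δ' : Module.End R A) (l : List A) :
    koszulOp (Δ + Δ') l = koszulOp Δ l + koszulOp Δ' l := by
  induction l generalizing Δ Δ' with
  | nil => rfl
  | cons a l ih =>
    rw [koszulOp_cons, koszulOp_cons, koszulOp_cons, ← ih]
    congr 1
    simp only [Ring.lie_def, mul_add, add_mul]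
    abel

theorem koszulOp_zero (l : List A) : koszulOp (0 : Module.End R A) l = 0 := by
  simpa using koszulOp_add (0 : Module.End R A) 0 l

theorem Derivation.lie_mulLeft (d : Derivation R A A) (a : A) :
    ⁅(d : Module.End R A), LinearMap.mulLeft R a⁆ = LinearMap.mulLeft R (d a) := by
  ext x
  simp [Ring.lie_def, mul_comm]

/-- The Leibniz rule for the commutator of a derivation with a nested commutator of
multiplication operators; `d` need not commute with `Δ`. -/
theorem Derivation.lie_koszulOp (d : Derivation R A A) (Δ : Module.End R A)
    {n : ℕ} (a : Fin n → A) :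
    ⁅(d : Module.End R A), koszulOp Δ (List.ofFn a)⁆ =
      koszulOp ⁅(d : Module.End R A), Δ⁆ (List.ofFn a) +
        ∑ i : Fin n, koszulOp Δ (List.ofFn (Function.update a i (d (a i)))) := by
  induction n generalizing Δ with
  | zero => simp [koszulOp]
  | succ n ih =>
    obtain ⟨a₀, a, rfl⟩ : ∃ a₀ a', a = Fin.cons a₀ a' := ⟨_, _, (Fin.cons_self_tail a).symm⟩
    simp only [Fin.sum_univ_succ, Fin.update_cons_zero, ← Fin.cons_update, Fin.cons_zero,
      Fin.cons_succ, List.ofFn_cons, koszulOp_cons, ih]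
    have jacobi : ⁅(d : Module.End R A), ⁅Δ, LinearMap.mulLeft R a₀⁆⁆ =
        ⁅⁅(d : Module.End R A), Δ⁆, LinearMap.mulLeft R a₀⁆ +
          ⁅Δ, ⁅(d : Module.End R A), LinearMap.mulLeft R a₀⁆⁆ := by
      simp only [Ring.lie_def, mul_sub, sub_mul, mul_assoc]
      abel
    rw [jacobi, d.lie_mulLeft, koszulOp_add, add_assoc]

end KoszulOp

/-- If `d` is an `R`-derivation of `A` commuting with `Δ`
(`d ∘ Δ = Δ ∘ d`), then `d` acts as a derivation over all Koszul brackets of `Δ`: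
`d(Φⁿ_Δ(a₁,…,a_n)) = Σᵢ Φⁿ_Δ(a₁,…,d(aᵢ),…,a_n)` for every `n ≥ 1`. -/
theorem derivation_leibniz_over_koszulBracket
    {R A : Type*} [CommRing R] [CommRing A] [Algebra R A]
    (Δ : Module.End R A) (d : Derivation R A A)
    (hdΔ : (d : Module.End R A) ∘ₗ Δ = Δ ∘ₗ (d : Module.End R A))
    (n : ℕ) (hn : 1 ≤ n) (a : Fin n → A) :
    d (koszulBracket Δ (List.ofFn a)) =
      ∑ i : Fin n, koszulBracket Δ (List.ofFn (Function.update a i (d (a i)))) := by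
  have hlie : ⁅(d : Module.End R A), Δ⁆ = 0 := sub_eq_zero.mpr hdΔ
  have h := congrArg (fun f : Module.End R A => f 1) (d.lie_koszulOp Δ a)
  simpa [hlie, koszulOp_zero, Ring.lie_def, koszulBracket] using h
end

section
/- Let R be a commutative ring, A a commutative unital R-algebra, and Δ : A → A an R-linear map. Suppose that for some n ≥ 1, the (n+1)-st Koszul bracket Φⁿ⁺¹_Δ vanishes identically on Aⁿ⁺¹. Then the n-th Koszul bracket Φⁿ_Δ is a derivation in each of its arguments; in particular, for all a₁,…,a_{n−1}, b, c ∈ A, Φⁿ_Δ(a₁,…,a_{n−1}, b·c) = Φⁿ_Δ(a₁,…,a_{n−1}, b)·c + b·Φⁿ_Δ(a₁,…,a_{n−1}, c). -/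
section KoszulBracket

variable {R A : Type*} [CommRing R] [CommRing A] [Algebra R A]

/-- The nested commutators do not depend on the order of the multiplication operators. -/
theorem koszulOp_perm (Δ : Module.End R A) {l₁ l₂ : List A} (h : l₁.Perm l₂) :
    koszulOp Δ l₁ = koszulOp Δ l₂ := by
  refine h.foldl_eq' (fun x _ y _ D => ?_) Δ
  ext z
  simp only [Ring.lie_def, LinearMap.sub_apply, Module.End.mul_apply, LinearMap.mulLeft_apply,
    map_sub, mul_left_comm x y z]
  ring

theorem koszulBracket_perm (Δ : Module.End R A) {l₁ l₂ : List A} (h : l₁.Perm l₂) :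
    koszulBracket Δ l₁ = koszulBracket Δ l₂ := by
  rw [koszulBracket, koszulOp_perm Δ h, koszulBracket]

/-- The bracket with one more argument measures the failure of the Leibniz rule. -/
theorem koszulBracket_append_pair (Δ : Module.End R A) (l : List A) (b c : A) :
    koszulBracket Δ (l ++ [b, c]) =
      koszulBracket Δ (l ++ [b * c]) -
        (koszulBracket Δ (l ++ [b]) * c + b * koszulBracket Δ (l ++ [c])) := by
  simp only [koszulBracket, koszulOp, List.foldl_append, List.foldl_cons, List.foldl_nil,
    Ring.lie_def, LinearMap.sub_apply, Module.End.mul_apply, LinearMap.mulLeft_apply, mul_one]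
  ring

theorem List.ofFn_update_perm {α : Type*} {n : ℕ} (a : Fin n → α) (i : Fin n) (x : α) :
    (List.ofFn (Function.update a i x)).Perm ((List.ofFn a).eraseIdx i ++ [x]) := by
  have h : List.ofFn (Function.update a i x) = (List.ofFn a).set i x := by
    refine List.ext_getElem (by simp) fun j _ _ => ?_
    simp [List.getElem_set, Function.update_apply, Fin.ext_iff, eq_comm]
  rw [h]
  exact (List.set_perm_cons_eraseIdx (by simp) x).trans (List.perm_append_singleton x _).symm

end KoszulBracket

/-- If for some `n ≥ 1` the `(n+1)`-st Koszul bracket of `Δ` vanishes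
identically, then the `n`-th Koszul bracket is a derivation in each of its arguments;
in particular it satisfies the Leibniz rule in its last argument. -/
theorem koszulBracket_multiderivation_of_next_vanishing
    {R A : Type*} [CommRing R] [CommRing A] [Algebra R A]
    (Δ : Module.End R A) (n : ℕ) (hn : 1 ≤ n)
    (hvan : ∀ a : Fin (n + 1) → A, koszulBracket Δ (List.ofFn a) = 0) :
    (∀ (a : Fin n → A) (i : Fin n) (b c : A),
        koszulBracket Δ (List.ofFn (Function.update a i (b * c))) =
          koszulBracket Δ (List.ofFn (Function.update a i b)) * c
            + b * koszulBracket Δ (List.ofFn (Function.update a i c)))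
      ∧ (∀ (a : Fin (n - 1) → A) (b c : A),
        koszulBracket Δ (List.ofFn a ++ [b * c]) =
          koszulBracket Δ (List.ofFn a ++ [b]) * c
            + b * koszulBracket Δ (List.ofFn a ++ [c])) := by
  have leibniz (l : List A) (hl : l.length + 1 = n) (b c : A) :
      koszulBracket Δ (l ++ [b * c]) =
        koszulBracket Δ (l ++ [b]) * c + b * koszulBracket Δ (l ++ [c]) := by
    rw [← sub_eq_zero, ← koszulBracket_append_pair]
    have hlen : (l ++ [b, c]).length = n + 1 := by simp; omega
    generalize l ++ [b, c] = l' at hlen ⊢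
    rw [← List.ofFn_get l', List.ofFn_congr hlen]
    exact hvan _
  refine ⟨fun a i b c => ?_, fun a b c => leibniz _ (by simp; omega) b c⟩
  simp only [koszulBracket_perm Δ (List.ofFn_update_perm a i _)]
  exact leibniz _ (by simp [List.length_eraseIdx]; omega) b c
end
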